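/- Let C be a commutative ring. A morphism f : B → C of commutative rings is of finite presentation in the categorical sense (the canonical map colim Hom_B(C, D_i) → Hom_B(C, colim D_i) is bijective for all filtered systems (D_i) of B-algebras) if and only if C is isomorphic as a B-algebra to a quotient B[T₁,…,T_n]/(r₁,…,r_m) of a polynomial ring in finitely many variables by finitely many relations. -/

import Mathlib

open CategoryTheory

/-- A directed (filtered) system of commutative `B`-algebras together with its colimit:
a directed index set, objects `Dᵢ` under `B`, transition maps, and a cocone `L` which is
a colimit (every element comes from some stage, and equality is detected at some stage). -/
structure RingDirSys (B : CommRingCat.{0}) where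
  ι : Type
  le : ι → ι → Prop
  lrefl : ∀ i, le i i
  ltrans : ∀ {i j k}, le i j → le j k → le i k
  nonmpty : Nonempty ι
  directed : ∀ i j, ∃ k, le i k ∧ le j k
  D : ι → CommRingCat.{0}
  alg : ∀ i, B ⟶ D i
  tr : ∀ {i j}, le i j → (D i ⟶ D j)
  tr_refl : ∀ i, tr (lrefl i) = 𝟙 (D i)
  tr_trans : ∀ {i j k} (h₁ : le i j) (h₂ : le j k), tr (ltrans h₁ h₂) = tr h₁ ≫ tr h₂
  tr_alg : ∀ {i j} (h : le i j), alg i ≫ tr h = alg j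
  L : CommRingCat.{0}
  algL : B ⟶ L
  incl : ∀ i, D i ⟶ L
  incl_alg : ∀ i, alg i ≫ incl i = algL
  incl_tr : ∀ {i j} (h : le i j), tr h ≫ incl j = incl i
  exists_rep : ∀ x : L, ∃ (i : ι) (y : D i), incl i y = x
  eq_stage : ∀ (i : ι) (x y : D i), incl i x = incl i y →
    ∃ (j : ι) (h : le i j), tr h x = tr h y

theorem RingDirSys.exists_ub {B : CommRingCat.{0}} (s : RingDirSys B) {κ : Type} [Finite κ]
    (f : κ → s.ι) : ∃ k, ∀ a, s.le (f a) k := by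
  classical
  have := Fintype.ofFinite κ
  suffices h : ∀ t : Finset κ, ∃ k, ∀ a ∈ t, s.le (f a) k by
    obtain ⟨k, hk⟩ := h Finset.univ
    exact ⟨k, fun a => hk a (Finset.mem_univ a)⟩
  intro t
  induction t using Finset.induction_on with
  | empty => exact ⟨s.nonmpty.some, by simp⟩
  | insert a t _ ih =>
    obtain ⟨k, hk⟩ := ih
    obtain ⟨m, h1, h2⟩ := s.directed (f a) k
    refine ⟨m, fun b hb => ?_⟩
    rcases Finset.mem_insert.1 hb with rfl | hb
    · exact h1
    · exact s.ltrans (hk b hb) h2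

theorem RingDirSys.tr_trans_apply {B : CommRingCat.{0}} (s : RingDirSys B) {i j k : s.ι}
    (h₁ : s.le i j) (h₂ : s.le j k) (x : s.D i) :
    s.tr (s.ltrans h₁ h₂) x = s.tr h₂ (s.tr h₁ x) := by
  rw [s.tr_trans]; rfl

theorem RingDirSys.incl_tr_apply {B : CommRingCat.{0}} (s : RingDirSys B) {i j : s.ι}
    (h₁ : s.le i j) (x : s.D i) : s.incl j (s.tr h₁ x) = s.incl i x := by
  rw [← s.incl_tr h₁]; rfl

theorem RingDirSys.exists_eq {B : CommRingCat.{0}} (s : RingDirSys B) (i : s.ι) {κ : Type}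
    [Finite κ] (x y : κ → s.D i) (h : ∀ a, s.incl i (x a) = s.incl i (y a)) :
    ∃ (j : s.ι) (h : s.le i j), ∀ a, s.tr h (x a) = s.tr h (y a) := by
  choose j hj e using fun a => s.eq_stage i (x a) (y a) (h a)
  obtain ⟨k, hk⟩ := s.exists_ub j
  obtain ⟨m, h1, h2⟩ := s.directed i k
  refine ⟨m, h1, fun a => ?_⟩
  have := congrArg (s.tr (s.ltrans (hk a) h2)) (e a)
  rwa [← s.tr_trans_apply, ← s.tr_trans_apply] at this

/-- The system of finitely generated subalgebras. -/
def fgSubalgSys (B C : Type) [CommRing B] [CommRing C] [Algebra B C] :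
    RingDirSys (CommRingCat.of B) where
  ι := {S : Subalgebra B C // S.FG}
  le S T := S.1 ≤ T.1
  lrefl _ := le_rfl
  ltrans := le_trans
  nonmpty := ⟨⟨⊥, Subalgebra.fg_bot⟩⟩
  directed S T := ⟨⟨S.1 ⊔ T.1, S.2.sup T.2⟩, le_sup_left, le_sup_right⟩
  D S := CommRingCat.of S.1
  alg S := CommRingCat.ofHom (algebraMap B S.1)
  tr h := CommRingCat.ofHom (Subalgebra.inclusion h).toRingHom
  tr_refl _ := rfl
  tr_trans _ _ := rfl
  tr_alg _ := rfl
  L := CommRingCat.of C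
  algL := CommRingCat.ofHom (algebraMap B C)
  incl S := CommRingCat.ofHom S.1.val.toRingHom
  incl_alg _ := rfl
  incl_tr _ := rfl
  exists_rep x := ⟨⟨Algebra.adjoin B {x}, ⟨{x}, by simp⟩⟩,
    ⟨x, Algebra.subset_adjoin rfl⟩, rfl⟩
  eq_stage i _ _ h := ⟨i, le_rfl, congrArg _ (Subtype.ext h)⟩

/-- The system of quotients by finitely generated subideals of the kernel. -/
def fgQuotSys {B C P : Type} [CommRing B] [CommRing C] [CommRing P] [Algebra B C] [Algebra B P]
    (f : P →ₐ[B] C) (hf : Function.Surjective f) :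
    RingDirSys (CommRingCat.of B) where
  ι := {J : Ideal P // J.FG ∧ J ≤ RingHom.ker f}
  le S T := S.1 ≤ T.1
  lrefl _ := le_rfl
  ltrans := le_trans
  nonmpty := ⟨⟨⊥, Submodule.fg_bot, bot_le⟩⟩
  directed S T := ⟨⟨S.1 ⊔ T.1, Submodule.FG.sup S.2.1 T.2.1, sup_le S.2.2 T.2.2⟩, le_sup_left, le_sup_right⟩
  D S := CommRingCat.of (P ⧸ S.1)
  alg S := CommRingCat.ofHom (algebraMap B (P ⧸ S.1))
  tr h := CommRingCat.ofHom (Ideal.Quotient.factor h)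
  tr_refl S := by
    ext x
    rfl
  tr_trans _ _ := by
    ext x
    rfl
  tr_alg _ := rfl
  L := CommRingCat.of C
  algL := CommRingCat.ofHom (algebraMap B C)
  incl S := CommRingCat.ofHom (Ideal.Quotient.lift S.1 f.toRingHom (fun a ha => S.2.2 ha))
  incl_alg S := by
    ext x
    exact f.commutes x
  incl_tr _ := by
    ext x
    rfl
  exists_rep x := by
    obtain ⟨y, rfl⟩ := hf x
    exact ⟨⟨⊥, Submodule.fg_bot, bot_le⟩, Ideal.Quotient.mk _ y, rfl⟩
  eq_stage i x y h := by
    obtain ⟨x, rfl⟩ := Ideal.Quotient.mk_surjective x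
    obtain ⟨y, rfl⟩ := Ideal.Quotient.mk_surjective y
    have h' : f x = f y := h
    refine ⟨⟨i.1 ⊔ Ideal.span {x - y}, Submodule.FG.sup i.2.1 ⟨{x - y}, by simp⟩, sup_le i.2.2 ?_⟩,
      le_sup_left, ?_⟩
    · rw [Ideal.span_singleton_le_iff_mem, RingHom.mem_ker, map_sub, h', sub_self]
    · exact Ideal.Quotient.eq.2 (Ideal.mem_sup_right (Ideal.subset_span rfl))

/-- A morphism `B → C` of commutative rings is of finite presentation in
the categorical sense — for every filtered system `(Dᵢ)` of `B`-algebras the canonical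
map `colim Hom_B(C, Dᵢ) → Hom_B(C, colim Dᵢ)` is bijective (expressed below via the
standard surjectivity and injectivity unfolding of that canonical map) — if and only if
`C` is isomorphic as a `B`-algebra to a quotient `B[T₁,…,T_n]/(r₁,…,r_m)` of a
polynomial ring in finitely many variables by a finitely generated ideal
(i.e. `Algebra.FinitePresentation B C`). -/
theorem stmt_16 (B C : Type) [CommRing B] [CommRing C] [Algebra B C] :
    (∀ s : RingDirSys (CommRingCat.of B),
      (∀ φ : CommRingCat.of C ⟶ s.L,
        CommRingCat.ofHom (algebraMap B C) ≫ φ = s.algL →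
        ∃ (i : s.ι) (ψ : CommRingCat.of C ⟶ s.D i),
          CommRingCat.ofHom (algebraMap B C) ≫ ψ = s.alg i ∧ ψ ≫ s.incl i = φ) ∧
      (∀ (i : s.ι) (ψ₁ ψ₂ : CommRingCat.of C ⟶ s.D i),
        CommRingCat.ofHom (algebraMap B C) ≫ ψ₁ = s.alg i →
        CommRingCat.ofHom (algebraMap B C) ≫ ψ₂ = s.alg i →
        ψ₁ ≫ s.incl i = ψ₂ ≫ s.incl i →
        ∃ (j : s.ι) (h : s.le i j), ψ₁ ≫ s.tr h = ψ₂ ≫ s.tr h))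
    ↔ Algebra.FinitePresentation B C := by
  constructor
  · intro H
    have hft : Algebra.FiniteType B C := by
      obtain ⟨S, ψ, -, h⟩ := (H (fgSubalgSys B C)).1 (𝟙 _) rfl
      have hS : S.1 = ⊤ := by
        refine eq_top_iff.2 fun x _ => ?_
        have hx : S.1.val (ψ.hom x) = x := congrArg (fun g => g.hom x) h
        rw [← hx]
        exact Subtype.property (p := fun c => c ∈ S.1) (ψ.hom x)
      exact ⟨hS ▸ S.2⟩
    obtain ⟨n, f, hf⟩ := Algebra.FiniteType.iff_quotient_mvPolynomial''.1 hft
    obtain ⟨J, ψ, hψ, h⟩ := (H (fgQuotSys f hf)).1 (𝟙 _) rfl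
    obtain ⟨K, hJK, e⟩ := (fgQuotSys f hf).exists_eq J
      (fun a : Fin n => ψ (f (MvPolynomial.X a)))
      (fun a : Fin n => (Ideal.Quotient.mk J.1 (MvPolynomial.X a)))
      (fun a => congrArg (fun g => g.hom (f (MvPolynomial.X a))) h)
    refine ⟨n, f, hf, ?_⟩
    have key : (((fgQuotSys f hf).tr hJK).hom.comp ψ.hom).comp f.toRingHom
        = Ideal.Quotient.mk K.1 := by
      apply MvPolynomial.ringHom_ext
      · intro b
        have h1 : f (MvPolynomial.C b) = algebraMap B C b := f.commutes b
        have h2 : ψ.hom (algebraMap B C b) = algebraMap B (_ ⧸ J.1) b :=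
          congrArg (fun g => g.hom b) hψ
        change (fgQuotSys f hf).tr hJK (ψ.hom (f (MvPolynomial.C b))) = _
        rw [h1, h2]
        rfl
      · intro a
        exact e a
    have : RingHom.ker f.toRingHom = K.1 := by
      refine le_antisymm (fun x hx => ?_) K.2.2
      refine Ideal.Quotient.eq_zero_iff_mem.1 ((congrArg (fun g => g x) key).symm.trans ?_)
      have hx' : f x = 0 := hx
      change ((fgQuotSys f hf).tr hJK).hom (ψ.hom (f x)) = 0
      rw [hx', map_zero, map_zero]
    rw [this]
    exact K.2.1
  · rintro ⟨n, f, hf, hfg⟩ s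
    have ext_gen : ∀ {R : CommRingCat.{0}} (u v : CommRingCat.of C ⟶ R),
        CommRingCat.ofHom (algebraMap B C) ≫ u = CommRingCat.ofHom (algebraMap B C) ≫ v →
        (∀ a, u (f (MvPolynomial.X a)) = v (f (MvPolynomial.X a))) → u = v := by
      intro R u v h1 h2
      have : u.hom.comp f.toRingHom = v.hom.comp f.toRingHom := by
        apply MvPolynomial.ringHom_ext
        · intro b
          have h3 : f (MvPolynomial.C b) = algebraMap B C b := f.commutes b
          change u.hom (f (MvPolynomial.C b)) = v.hom (f (MvPolynomial.C b))
          rw [h3]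
          exact congrArg (fun g => g.hom b) h1
        · exact h2
      ext x
      obtain ⟨y, rfl⟩ := hf x
      exact congrArg (fun g => g y) this
    refine ⟨fun φ hφ => ?_, fun i ψ₁ ψ₂ h1 h2 h => ?_⟩
    · choose i₀ y₀ hy₀ using fun a : Fin n => s.exists_rep (φ (f (MvPolynomial.X a)))
      obtain ⟨i, hi⟩ := s.exists_ub i₀
      let g : MvPolynomial (Fin n) B →+* s.D i :=
        MvPolynomial.eval₂Hom (s.alg i).hom (fun a => s.tr (hi a) (y₀ a))
      have hg : (s.incl i).hom.comp g = φ.hom.comp f.toRingHom := by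
        apply MvPolynomial.ringHom_ext
        · intro b
          have h3 : f (MvPolynomial.C b) = algebraMap B C b := f.commutes b
          change (s.incl i).hom (g (MvPolynomial.C b)) = φ.hom (f (MvPolynomial.C b))
          rw [h3, MvPolynomial.eval₂Hom_C]
          exact congrArg (fun g => g.hom b) ((s.incl_alg i).trans hφ.symm)
        · intro a
          change (s.incl i).hom (g (MvPolynomial.X a)) = φ.hom (f (MvPolynomial.X a))
          rw [MvPolynomial.eval₂Hom_X']
          exact (s.incl_tr_apply _ _).trans (hy₀ a)
      obtain ⟨t, ht⟩ := hfg
      obtain ⟨j, hij, e⟩ := s.exists_eq i (κ := t) (fun r => g r.1) (fun _ => 0) (by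
        intro r
        have hr : f.toRingHom r.1 = 0 := by
          have : r.1 ∈ RingHom.ker f.toRingHom := ht ▸ Ideal.subset_span r.2
          exact this
        have := congrArg (fun g => g r.1) hg
        refine Eq.trans this ?_
        rw [RingHom.comp_apply, hr, map_zero, map_zero])
      have hker : RingHom.ker f.toRingHom ≤ RingHom.ker ((s.tr hij).hom.comp g) := by
        rw [← ht]
        refine Ideal.span_le.2 fun r hr => ?_
        exact (e ⟨r, hr⟩).trans (map_zero _)
      let ψ : C →+* s.D j := f.toRingHom.liftOfSurjective hf ⟨(s.tr hij).hom.comp g, hker⟩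
      have hψ : ∀ p, ψ (f p) = s.tr hij (g p) := fun p =>
        RingHom.liftOfRightInverse_comp_apply f.toRingHom _ _ ⟨(s.tr hij).hom.comp g, hker⟩ p
      have hB : CommRingCat.ofHom (algebraMap B C) ≫ CommRingCat.ofHom ψ = s.alg j := by
        ext b
        change ψ (algebraMap B C b) = _
        have h3 : f (MvPolynomial.C b) = algebraMap B C b := f.commutes b
        rw [← h3, hψ, MvPolynomial.eval₂Hom_C]
        exact congrArg (fun g => g.hom b) (s.tr_alg hij)
      refine ⟨j, CommRingCat.ofHom ψ, hB, ?_⟩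
      ext x
      obtain ⟨p, rfl⟩ := hf x
      change s.incl j (ψ (f p)) = φ (f p)
      rw [hψ, s.incl_tr_apply]
      exact congrArg (fun g => g p) hg
    · obtain ⟨j, hij, e⟩ := s.exists_eq i (fun a => ψ₁ (f (MvPolynomial.X a)))
        (fun a => ψ₂ (f (MvPolynomial.X a)))
        (fun a => congrArg (fun g => g.hom (f (MvPolynomial.X a))) h)
      refine ⟨j, hij, ext_gen _ _ ?_ e⟩
      rw [← Category.assoc, ← Category.assoc, h1, h2]
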